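/- If −δ₁ ≤ δ < δ₁, then |u_δ(x)| < 1 for every x ∈ ℝ. -/

import Mathlib

noncomputable section

open Real Filter Topology intervalIntegral

/-- The normalized nonlinearity `f_{a,A}`: `f/a` where `f > 0`, `f/A` where `f < 0`,
and `0` where `f = 0`. -/
def faA (a A : ℝ) (f : ℝ → ℝ) (t : ℝ) : ℝ :=
  if 0 < f t then f t / a else if f t < 0 then f t / A else 0

/-- `u` is a weak solution of `-|u'|^α u'' = f_{a,A}(u)` on all of `ℝ`:
`u` is C¹ and `x ↦ |u'|^α u'` is differentiable with (continuous) derivative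
`-(1+α)·f_{a,A}(u(x))`. -/
def IsWeakSolR (α a A : ℝ) (f : ℝ → ℝ) (u : ℝ → ℝ) : Prop :=
  Differentiable ℝ u ∧ Continuous (deriv u) ∧
  ∀ x : ℝ, HasDerivAt (fun y => |deriv u y| ^ α * deriv u y)
    (-(1 + α) * faA a A f (u x)) x

theorem faA_eq_max_add_min (a A : ℝ) (f : ℝ → ℝ) :
    faA a A f = fun t => max (f t) 0 / a + min (f t) 0 / A := by
  funext t
  unfold faA
  rcases lt_trichotomy (f t) 0 with h | h | h
  · simp [h, h.le, not_lt.2 h.le]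
  · simp [h]
  · simp [h, h.le]

theorem continuous_faA {f : ℝ → ℝ} (hf : Continuous f) (a A : ℝ) : Continuous (faA a A f) := by
  rw [faA_eq_max_add_min]
  fun_prop

theorem abs_faA_le {a A : ℝ} (ha : 0 < a) (haA : a ≤ A) (f : ℝ → ℝ) (t : ℝ) :
    |faA a A f t| ≤ |f t| / a := by
  unfold faA
  split_ifs
  · rw [abs_div, abs_of_pos ha]
  · rw [abs_div, abs_of_pos (ha.trans_le haA)]
    gcongr
  · rw [abs_zero]
    positivity

/-- Near a zero `c` of a Lipschitz `f`, the primitive of `faA a A f` is quadratically close to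
its value at `c`. -/
theorem abs_integral_faA_le {a A : ℝ} (ha : 0 < a) (haA : a ≤ A) {f : ℝ → ℝ} {K : NNReal}
    (hf : LipschitzWith K f) {c : ℝ} (hc : f c = 0) (t : ℝ) :
    |∫ s in t..c, faA a A f s| ≤ K / a * |t - c| ^ 2 := by
  have h : ∀ s ∈ Set.uIoc t c, ‖faA a A f s‖ ≤ K / a * |t - c| := by
    intro s hs
    have hsc : |s - c| ≤ |t - c| := by
      have := Set.abs_sub_right_of_mem_uIcc (Set.uIoc_subset_uIcc hs)
      rwa [abs_sub_comm c s, abs_sub_comm c t] at this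
    have hfs : |f s| ≤ K * |s - c| := by
      simpa [Real.dist_eq, hc] using hf.dist_le_mul s c
    calc ‖faA a A f s‖ ≤ |f s| / a := abs_faA_le ha haA f s
      _ ≤ K * |t - c| / a := by
        gcongr
        exact hfs.trans (by gcongr)
      _ = K / a * |t - c| := by ring
  have := norm_integral_le_of_norm_le_const h
  rw [Real.norm_eq_abs, abs_sub_comm c t] at this
  linarith [sq (|t - c|)]

/-- A differentiable function with `|g'| ≤ C |g| ^ q`, `q ≥ 1`, that vanishes at one point
vanishes identically. -/
theorem eq_zero_of_abs_deriv_le_rpow {g : ℝ → ℝ} {C q : ℝ} (hg : Differentiable ℝ g)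
    (hC : 0 ≤ C) (hq : 1 ≤ q) (hbound : ∀ x, |deriv g x| ≤ C * |g x| ^ q) {x₀ : ℝ}
    (hx₀ : g x₀ = 0) (y : ℝ) : g y = 0 := by
  let h : ℝ → ℝ := fun t => g (x₀ + t * (y - x₀))
  have hh : ∀ t, HasDerivAt h (deriv g (x₀ + t * (y - x₀)) * (y - x₀)) t := by
    intro t
    refine (hg _).hasDerivAt.comp t ?_
    simpa using ((hasDerivAt_id t).mul_const (y - x₀)).const_add x₀
  have hcont : Continuous h := continuous_iff_continuousAt.2 fun t => (hh t).continuousAt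
  obtain ⟨M, hM⟩ := isCompact_Icc.exists_bound_of_continuousOn
    (f := fun t => |h t| ^ (q - 1)) (s := Set.Icc 0 1)
    ((hcont.abs.rpow_const fun _ => Or.inr (by linarith)).continuousOn)
  have key := eq_zero_of_abs_deriv_le_mul_abs_self_of_eq_zero_right (f := h)
    (K := C * M * |y - x₀|) (a := 0) (b := 1) hcont.continuousOn
    (fun t _ => (hh t).hasDerivWithinAt) (by simp [h, hx₀]) ?_ 1 (by simp)
  · simpa [h] using key
  · intro t ht
    have hMt : |h t| ^ (q - 1) ≤ M := (le_abs_self _).trans (hM t ⟨ht.1, ht.2.le⟩)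
    have hpow : |h t| ^ q = |h t| ^ (q - 1) * |h t| := by
      rcases (abs_nonneg (h t)).eq_or_lt with h0 | h0
      · rw [← h0, Real.zero_rpow (by linarith), mul_zero]
      · rw [← Real.rpow_add_one h0.ne', sub_add_cancel]
    rw [Real.norm_eq_abs, Real.norm_eq_abs, abs_mul]
    calc |deriv g (x₀ + t * (y - x₀))| * |y - x₀| ≤ C * |h t| ^ q * |y - x₀| := by
          gcongr
          exact hbound _
      _ = C * |h t| ^ (q - 1) * |y - x₀| * |h t| := by rw [hpow]; ring
      _ ≤ C * M * |y - x₀| * |h t| := by gcongr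

/-- Conservation of the energy `|u'| ^ (2 + α) + (2 + α) F(u)`, `F` being the primitive of
`faA a A f` vanishing at `0`. -/
theorem IsWeakSolR.energy_eq {α a A : ℝ} (hα : -1 < α) {f : ℝ → ℝ} (hf : Continuous f)
    {u : ℝ → ℝ} (hu : IsWeakSolR α a A f u) (x y : ℝ) :
    |deriv u x| ^ (2 + α) + (2 + α) * ∫ s in (0 : ℝ)..u x, faA a A f s =
      |deriv u y| ^ (2 + α) + (2 + α) * ∫ s in (0 : ℝ)..u y, faA a A f s := by
  have hα' : 0 < 1 + α := by linarith
  have hp : 1 < (2 + α) / (1 + α) := by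
    rw [lt_div_iff₀ hα']
    linarith
  have habs : ∀ z : ℝ, |(|z| ^ α * z)| = |z| ^ (1 + α) := by
    intro z
    rcases eq_or_ne z 0 with rfl | hz
    · simp [Real.zero_rpow hα'.ne']
    · rw [abs_mul, abs_of_nonneg (by positivity : 0 ≤ |z| ^ α), add_comm 1 α,
        Real.rpow_add_one (abs_pos.2 hz).ne']
  have hpow : ∀ z : ℝ, |(|z| ^ α * z)| ^ ((2 + α) / (1 + α)) = |z| ^ (2 + α) := by
    intro z
    rw [habs, ← Real.rpow_mul (abs_nonneg z), mul_div_cancel₀ _ hα'.ne']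
  have hinv : ∀ z : ℝ, |(|z| ^ α * z)| ^ ((2 + α) / (1 + α) - 2) * (|z| ^ α * z) = z := by
    intro z
    rcases eq_or_ne z 0 with rfl | hz
    · simp
    · have hz' := abs_pos.2 hz
      rw [habs, ← Real.rpow_mul hz'.le, ← mul_assoc, ← Real.rpow_add hz']
      have : (1 + α) * ((2 + α) / (1 + α) - 2) + α = 0 := by
        field_simp
        ring
      rw [this, Real.rpow_zero, one_mul]
  have hkin : ∀ t, HasDerivAt (fun t => |deriv u t| ^ (2 + α))
      (-(2 + α) * (faA a A f (u t) * deriv u t)) t := by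
    intro t
    have h := HasDerivAt.comp (h := fun y => |deriv u y| ^ α * deriv u y) t
      (hasDerivAt_abs_rpow (|deriv u t| ^ α * deriv u t) hp) (hu.2.2 t)
    have hfun : (fun t => |deriv u t| ^ (2 + α)) =
        (fun z : ℝ => |z| ^ ((2 + α) / (1 + α))) ∘ fun t => |deriv u t| ^ α * deriv u t := by
      funext t
      exact (hpow _).symm
    rw [hfun]
    refine h.congr_deriv ?_
    rw [mul_assoc ((2 + α) / (1 + α)), hinv]
    field_simp
  have hpot : ∀ t, HasDerivAt (fun t => ∫ s in (0 : ℝ)..u t, faA a A f s)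
      (faA a A f (u t) * deriv u t) t := by
    intro t
    have hc := continuous_faA hf a A
    exact (hc.integral_hasStrictDerivAt 0 (u t)).hasDerivAt.comp t (hu.1 t).hasDerivAt
  have hE : ∀ t, HasDerivAt (fun t => |deriv u t| ^ (2 + α) +
      (2 + α) * ∫ s in (0 : ℝ)..u t, faA a A f s) 0 t := by
    intro t
    exact ((hkin t).add ((hpot t).const_mul (2 + α))).congr_deriv (by ring)
  exact is_const_of_deriv_eq_zero (fun t => (hE t).differentiableAt) (fun t => (hE t).deriv) x y

/-- A weak solution whose energy is at most the potential level of a zero `c` of `f` can only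
take the value `c` if it is constant. -/
theorem IsWeakSolR.ne_of_energy_le {α a A : ℝ} (hα : -1 < α) (hα0 : α ≤ 0) (ha : 0 < a)
    (haA : a ≤ A) {f : ℝ → ℝ} {K : NNReal} (hf : LipschitzWith K f) {u : ℝ → ℝ}
    (hu : IsWeakSolR α a A f u) {c x₀ : ℝ} (hc : f c = 0) (hx₀ : u x₀ ≠ c)
    (henergy : |deriv u x₀| ^ (2 + α) + (2 + α) * ∫ s in (0 : ℝ)..u x₀, faA a A f s ≤
      (2 + α) * ∫ s in (0 : ℝ)..c, faA a A f s) (x : ℝ) : u x ≠ c := by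
  intro hx
  have hα' : 0 < 2 + α := by linarith
  have hint := fun p q : ℝ =>
    (continuous_faA hf.continuous a A).intervalIntegrable (μ := MeasureTheory.volume) p q
  have hC : 0 ≤ (2 + α) * (K / a) := by positivity
  have hbound : ∀ y, |deriv (fun y => u y - c) y| ≤
      ((2 + α) * (K / a)) ^ (1 / (2 + α)) * |u y - c| ^ (2 / (2 + α)) := by
    intro y
    have hE := hu.energy_eq hα hf.continuous y x₀
    have hadd := integral_add_adjacent_intervals (hint 0 (u y)) (hint (u y) c)
    have hle := (le_abs_self _).trans (abs_integral_faA_le ha haA hf hc (u y))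
    have hmain : |deriv u y| ^ (2 + α) ≤ (2 + α) * (K / a) * |u y - c| ^ 2 := by
      rw [← hadd] at henergy
      nlinarith [mul_le_mul_of_nonneg_left hle hα'.le]
    have hroot := Real.rpow_le_rpow (by positivity) hmain (by positivity : 0 ≤ 1 / (2 + α))
    rw [← Real.rpow_mul (abs_nonneg _), mul_one_div_cancel hα'.ne', Real.rpow_one,
      Real.mul_rpow hC (by positivity), ← Real.rpow_natCast, ← Real.rpow_mul (abs_nonneg _)] at hroot
    rw [deriv_sub_const]
    convert hroot using 3
    push_cast
    ring
  refine hx₀ (sub_eq_zero.1 (eq_zero_of_abs_deriv_le_rpow (hu.1.sub_const c) (by positivity)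
    ?_ hbound (sub_eq_zero.2 hx) x₀))
  rw [le_div_iff₀ hα']
  linarith

/-- **Proposition 5.2, case 3.** If `-δ₁ ≤ δ < δ₁`, then `|u_δ(x)| < 1` for every
`x ∈ ℝ`. -/
theorem cauchy_case_subcritical
    (α a A : ℝ) (hα : -1 < α) (hα0 : α ≤ 0) (ha : 0 < a) (haA : a ≤ A)
    (f : ℝ → ℝ) (hf : ContDiff ℝ 1 f)
    (hfm1 : f (-1) = 0) (hf0 : f 0 = 0) (hf1 : f 1 = 0)
    (hfpos : ∀ t ∈ Set.Ioo (0:ℝ) 1, 0 < f t)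
    (hfneg : ∀ t ∈ Set.Ioo (-1:ℝ) 0, f t < 0)
    (hfge : ∀ t : ℝ, t ≤ -1 → 0 ≤ f t)
    (hfle : ∀ t : ℝ, 1 ≤ t → f t ≤ 0)
    (hfbd : ∃ K : ℝ, ∀ t, |f t| ≤ K)
    (hfLip : ∃ K : NNReal, LipschitzWith K f)
    (hfd1 : deriv f 1 < 0) (hfdm1 : deriv f (-1) < 0)
    (hbal : (∫ s in (-1:ℝ)..1, faA a A f s) = 0)
    (hint : ∀ t : ℝ, t ≠ -1 → t ≠ 1 → 0 < ∫ s in t..1, faA a A f s)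
    (δ δ₁ : ℝ)
    (hδ₁ : δ₁ = ((2 + α) * ∫ s in (0:ℝ)..1, f s / a) ^ ((1:ℝ) / (2 + α)))
    (u : ℝ → ℝ) (hu : IsWeakSolR α a A f u)
    (hu0 : u 0 = 0) (hud0 : deriv u 0 = δ)
    (hδlow : -δ₁ ≤ δ) (hδhigh : δ < δ₁) :
    ∀ x : ℝ, |u x| < 1 := by
  obtain ⟨K, hK⟩ := hfLip
  have hα' : 0 < 2 + α := by linarith
  have hcont := continuous_faA hf.continuous a A
  have hI : ∫ s in (0 : ℝ)..1, f s / a = ∫ s in (0 : ℝ)..1, faA a A f s := by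
    refine integral_congr_Ioo_of_le zero_le_one fun s hs => ?_
    simp [faA, hfpos s hs]
  have hI0 : 0 ≤ ∫ s in (0 : ℝ)..1, faA a A f s :=
    (hint 0 (by norm_num) (by norm_num)).le
  have hIm1 : ∫ s in (0 : ℝ)..(-1), faA a A f s = ∫ s in (0 : ℝ)..1, faA a A f s := by
    have := integral_add_adjacent_intervals (hcont.intervalIntegrable (μ := MeasureTheory.volume)
      0 (-1)) (hcont.intervalIntegrable (-1) 1)
    linarith
  have hδpow : |deriv u 0| ^ (2 + α) ≤ (2 + α) * ∫ s in (0 : ℝ)..1, faA a A f s := by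
    have habs : |δ| ≤ δ₁ := abs_le.2 ⟨hδlow, hδhigh.le⟩
    rw [hud0]
    refine (Real.rpow_le_rpow (abs_nonneg δ) habs hα'.le).trans_eq ?_
    rw [hδ₁, hI, ← Real.rpow_mul (by positivity), one_div_mul_cancel hα'.ne', Real.rpow_one]
  have hne1 := hu.ne_of_energy_le hα hα0 ha haA hK (c := 1) (x₀ := 0) hf1 (by simp [hu0])
    (by simpa [hu0] using hδpow)
  have hnem1 := hu.ne_of_energy_le hα hα0 ha haA hK (c := -1) (x₀ := 0) hfm1 (by simp [hu0])
    (by rw [hIm1]; simpa [hu0] using hδpow)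
  intro x
  by_contra! hx
  have h0 : |u 0| ≤ 1 := by simp [hu0]
  obtain ⟨y, hy⟩ := mem_range_of_exists_le_of_exists_ge hu.1.continuous.abs ⟨0, h0⟩ ⟨x, hx⟩
  rcases (abs_eq zero_le_one).1 hy with h | h
  · exact hne1 y h
  · exact hnem1 y h
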